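/- Let k be a positive even integer and let G be a connected, false twin-free, total k-uniform graph. Then G is regular. -/

import Mathlib

open SimpleGraph

/-- `A ⊆ V(G)` is a total dominating set of `G`: every vertex has a neighbor in `A`. -/
def TotalDomSet {V : Type*} (G : SimpleGraph V) (A : Set V) : Prop :=
  ∀ v : V, ∃ a ∈ A, G.Adj v a

/-- `s` is a legal (open neighborhood) sequence of `G`: the vertices are distinct and every
vertex after the first has a neighbor adjacent to no vertex preceding it in the sequence. -/
def LegalSeq {V : Type*} (G : SimpleGraph V) (s : List V) : Prop :=
  s.Nodup ∧ ∀ (i : ℕ) (h : i < s.length), 0 < i →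
    ∃ w : V, G.Adj (s.get ⟨i, h⟩) w ∧ ∀ u ∈ s.take i, ¬ G.Adj u w

/-- `s` is a total dominating sequence of `G`: a legal sequence whose underlying set is a
total dominating set. -/
def TotalDomSeq {V : Type*} (G : SimpleGraph V) (s : List V) : Prop :=
  LegalSeq G s ∧ TotalDomSet G {v | v ∈ s}

/-- The total domination number `γ_t(G)`: the minimum size of a total dominating set. -/
noncomputable def totalDomNum {V : Type*} (G : SimpleGraph V) : ℕ :=
  sInf {n | ∃ A : Set V, TotalDomSet G A ∧ A.ncard = n}

/-- The Grundy total domination number `γ_gr^t(G)`: the maximum length of a total dominating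
sequence. -/
noncomputable def grundyTotalDomNum {V : Type*} (G : SimpleGraph V) : ℕ :=
  sSup {n | ∃ s : List V, TotalDomSeq G s ∧ s.length = n}

/-- `G` is total `k`-uniform if `γ_t(G) = γ_gr^t(G) = k`. -/
def TotalKUniform {V : Type*} (G : SimpleGraph V) (k : ℕ) : Prop :=
  totalDomNum G = k ∧ grundyTotalDomNum G = k

/-- `G` has no isolated vertices. -/
def NoIsolatedVerts {V : Type*} (G : SimpleGraph V) : Prop :=
  ∀ v : V, ∃ w : V, G.Adj v w

/-- The closed neighborhood `N[v] = N(v) ∪ {v}`. -/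
def closedNbhd {V : Type*} (G : SimpleGraph V) (v : V) : Set V :=
  insert v (G.neighborSet v)

/-- `G` is false twin-free: no two distinct vertices have the same (open) neighborhood. -/
def FalseTwinFree {V : Type*} (G : SimpleGraph V) : Prop :=
  ∀ u v : V, u ≠ v → G.neighborSet u ≠ G.neighborSet v

/-- `G` is regular: all vertices have the same degree. -/
def IsRegularGraph {V : Type*} (G : SimpleGraph V) : Prop :=
  ∀ u v : V, (G.neighborSet u).ncard = (G.neighborSet v).ncard

/-- The union of the open neighborhoods of the vertices of `C`. -/
def openNbhd {V : Type*} (G : SimpleGraph V) (C : Set V) : Set V :=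
  {w | ∃ c ∈ C, G.Adj c w}

theorem openNbhd_insert {V : Type*} (G : SimpleGraph V) (x : V) (C : Set V) :
    openNbhd G (insert x C) = G.neighborSet x ∪ openNbhd G C := by
  ext w
  simp [openNbhd]

theorem openNbhd_singleton {V : Type*} (G : SimpleGraph V) (x : V) :
    openNbhd G {x} = G.neighborSet x := by
  ext w
  simp [openNbhd]

theorem openNbhd_empty {V : Type*} (G : SimpleGraph V) : openNbhd G ∅ = ∅ := by
  ext w
  simp [openNbhd]

theorem LegalSeq.nil {V : Type*} (G : SimpleGraph V) : LegalSeq G [] :=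
  ⟨List.nodup_nil, fun i h => absurd h (Nat.not_lt_zero i)⟩

theorem LegalSeq.concat {V : Type*} {G : SimpleGraph V} {s : List V} (hs : LegalSeq G s) {x w : V}
    (hxw : G.Adj x w) (hw : ∀ u ∈ s, ¬ G.Adj u w) : LegalSeq G (s ++ [x]) := by
  refine ⟨?_, fun i hi hi0 => ?_⟩
  · rw [List.nodup_append]
    refine ⟨hs.1, List.nodup_singleton x, fun a ha b hb hab => ?_⟩
    rw [List.mem_singleton] at hb
    subst hab hb
    exact hw _ ha hxw
  · by_cases h : i < s.length
    · obtain ⟨z, hz, hz'⟩ := hs.2 i h hi0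
      refine ⟨z, ?_, ?_⟩
      · simpa [List.getElem_append_left h] using hz
      · rwa [List.take_append_of_le_length h.le]
    · have hi' : i = s.length := by
        simp at hi
        omega
      subst hi'
      exact ⟨w, by simpa using hxw, by simpa using hw⟩

/-- A legal sequence can be extended by vertices of `C` to one dominating all neighbors of `C`. -/
theorem LegalSeq.exists_extend {V : Type*} [Finite V] {G : SimpleGraph V} (C : Set V) {s : List V}
    (hs : LegalSeq G s) : ∃ t : List V, LegalSeq G (s ++ t) ∧ (∀ v ∈ t, v ∈ C) ∧
      ∀ w ∈ openNbhd G C, ∃ u ∈ s ++ t, G.Adj u w := by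
  have := Fintype.ofFinite V
  induction h : Fintype.card V - s.length using Nat.strong_induction_on generalizing s with
  | _ n ih =>
    by_cases hd : ∀ w ∈ openNbhd G C, ∃ u ∈ s, G.Adj u w
    · exact ⟨[], by simpa using hs, by simp, by simpa using hd⟩
    · push Not at hd
      obtain ⟨w, ⟨c, hc, hcw⟩, hw⟩ := hd
      have hs' := hs.concat hcw hw
      have hlen := hs'.1.length_le_card
      simp only [List.length_append, List.length_singleton] at hlen
      obtain ⟨t, ht, htC, hdom⟩ := ih _ (by simp; omega) hs' rfl
      refine ⟨c :: t, by simpa using ht, ?_, by simpa using hdom⟩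
      simpa using ⟨hc, htC⟩

theorem TotalKUniform.le_ncard {V : Type*} {G : SimpleGraph V} {k : ℕ} (h : TotalKUniform G k)
    {A : Set V} (hA : TotalDomSet G A) : k ≤ A.ncard :=
  h.1 ▸ Nat.sInf_le ⟨A, hA, rfl⟩

theorem TotalKUniform.length_le {V : Type*} [Finite V] {G : SimpleGraph V} {k : ℕ}
    (h : TotalKUniform G k) (hiso : NoIsolatedVerts G) {s : List V} (hs : LegalSeq G s) :
    s.length ≤ k := by
  have := Fintype.ofFinite V
  obtain ⟨t, ht, -, hdom⟩ := hs.exists_extend Set.univ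
  have hle : (s ++ t).length ≤ k := by
    rw [← h.2]
    refine le_csSup ⟨Fintype.card V, ?_⟩ ⟨s ++ t, ⟨ht, fun v => ?_⟩, rfl⟩
    · rintro n ⟨l, hl, rfl⟩
      exact hl.1.1.length_le_card
    · obtain ⟨w, hw⟩ := hiso v
      obtain ⟨u, hu, huv⟩ := hdom v ⟨w, trivial, hw.symm⟩
      exact ⟨u, hu, huv.symm⟩
  simp only [List.length_append] at hle
  omega

theorem Set.ncard_mem_list_le {V : Type*} (s : List V) : {v | v ∈ s}.ncard ≤ s.length := by
  classical
  have h : {v | v ∈ s} = (s.toFinset : Set V) := by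
    ext
    simp
  rw [h, Set.ncard_coe_finset]
  exact s.toFinset_card_le

/-- A list dominating every vertex of a total `k`-uniform graph has length at least `k`. -/
theorem TotalKUniform.le_length {V : Type*} {G : SimpleGraph V} {k : ℕ} (h : TotalKUniform G k)
    {s : List V} (hs : ∀ v, ∃ u ∈ s, G.Adj u v) : k ≤ s.length := by
  refine (h.le_ncard fun v => ?_).trans (Set.ncard_mem_list_le s)
  obtain ⟨u, hu, huv⟩ := hs v
  exact ⟨u, hu, huv.symm⟩

/-- Open neighborhoods in a total `k`-uniform graph satisfy the matroid exchange property. -/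
theorem TotalKUniform.exchange {V : Type*} [Finite V] {G : SimpleGraph V} {k : ℕ}
    (h : TotalKUniform G k) (hiso : NoIsolatedVerts G) (C : Set V) {x y : V}
    (hyx : G.neighborSet y ⊆ G.neighborSet x ∪ openNbhd G C)
    (hy : ¬ G.neighborSet y ⊆ openNbhd G C) :
    G.neighborSet x ⊆ G.neighborSet y ∪ openNbhd G C := by
  intro z hz
  by_contra hzn
  rw [Set.mem_union, not_or] at hzn
  obtain ⟨w, hyw, hw⟩ := Set.not_subset.1 hy
  obtain ⟨s, hs, hsC, hdom⟩ := (LegalSeq.nil G).exists_extend C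
  simp only [List.nil_append] at hs hdom
  have h₁ := hs.concat hyw fun u hu huw => hw ⟨u, hsC u hu, huw⟩
  have h₂ := h₁.concat hz (by
    intro u hu huz
    rw [List.mem_append, List.mem_singleton] at hu
    rcases hu with hu | rfl
    · exact hzn.2 ⟨u, hsC u hu, huz⟩
    · exact hzn.1 huz)
  obtain ⟨t, ht, -, htdom⟩ := h₂.exists_extend Set.univ
  have hle := h.length_le hiso ht
  have hge : k ≤ (s ++ x :: t).length := by
    refine h.le_length fun v => ?_
    obtain ⟨p, hp⟩ := hiso v
    obtain ⟨u, hu, huv⟩ := htdom v ⟨p, trivial, hp.symm⟩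
    simp only [List.mem_append, List.mem_singleton] at hu
    rcases hu with ((hu | rfl) | rfl) | hu
    · exact ⟨u, by simp [hu], huv⟩
    · rcases hyx huv with hxv | hCv
      · exact ⟨x, by simp, hxv⟩
      · obtain ⟨a, ha, hav⟩ := hdom v hCv
        exact ⟨a, by simp [ha], hav⟩
    · exact ⟨u, by simp, huv⟩
    · exact ⟨u, by simp [hu], huv⟩
  simp only [List.length_append, List.length_cons, List.length_nil] at hle hge
  omega

theorem TotalKUniform.eq_of_neighborSet_subset {V : Type*} [Finite V] {G : SimpleGraph V} {k : ℕ}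
    (h : TotalKUniform G k) (hiso : NoIsolatedVerts G) (hftf : FalseTwinFree G) {x y : V}
    (hyx : G.neighborSet y ⊆ G.neighborSet x) : y = x := by
  by_contra hne
  refine hftf y x hne (hyx.antisymm ?_)
  have := h.exchange hiso ∅ (x := x) (y := y)
  simp only [openNbhd_empty, Set.union_empty, Set.subset_empty_iff] at this
  refine this hyx fun he => ?_
  obtain ⟨w, hw⟩ := hiso y
  exact (he ▸ hw : w ∈ (∅ : Set V))

/-- In the geometry of a total `k`-uniform graph, every line meets every hyperplane. -/
theorem TotalKUniform.exists_mem_line {V : Type*} [Finite V] {G : SimpleGraph V} {k : ℕ}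
    (h : TotalKUniform G k) (hiso : NoIsolatedVerts G) (hftf : FalseTwinFree G) {x w : V}
    (hxw : x ≠ w) (v : V) :
    ∃ z, ¬ G.Adj z v ∧ G.neighborSet z ⊆ G.neighborSet x ∪ G.neighborSet w := by
  obtain ⟨s, hs, hsD, hdom⟩ := (LegalSeq.nil G).exists_extend {p | ¬ G.Adj p x ∧ ¬ G.Adj p w}
  simp only [List.nil_append] at hs hdom
  obtain ⟨p, hpw, hpx⟩ := Set.not_subset.1
    fun hsub => hxw (h.eq_of_neighborSet_subset hiso hftf (y := w) (x := x) hsub).symm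
  obtain ⟨q, hq⟩ := hiso x
  have h₁ := hs.concat (x := p) (w := w) (G.adj_symm hpw) fun u hu => (hsD u hu).2
  have h₂ := h₁.concat (x := q) (w := x) hq.symm (by
    intro u hu hux
    rw [List.mem_append, List.mem_singleton] at hu
    rcases hu with hu | rfl
    · exact (hsD u hu).1 hux
    · exact hpx hux.symm)
  have hle := h.length_le hiso h₂
  by_contra! hcon
  have hge : k ≤ (s ++ [v]).length := by
    refine h.le_length fun z => ?_
    by_cases hzv : G.Adj z v
    · exact ⟨v, by simp, hzv.symm⟩
    · obtain ⟨t, hzt, ht⟩ := Set.not_subset.1 (hcon z hzv)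
      rw [Set.mem_union, not_or] at ht
      obtain ⟨u, hu, huz⟩ := hdom z
        ⟨t, ⟨fun e => ht.1 e.symm, fun e => ht.2 e.symm⟩, G.adj_symm hzt⟩
      exact ⟨u, by simp [hu], huz⟩
  simp only [List.length_append, List.length_cons, List.length_nil] at hle hge
  omega

theorem TotalKUniform.ncard_compl_le {V : Type*} [Finite V] {G : SimpleGraph V} {k : ℕ}
    (h : TotalKUniform G k) (hiso : NoIsolatedVerts G) (hftf : FalseTwinFree G) {u v w : V}
    (hwu : G.Adj w u) (hwv : G.Adj w v) :
    (G.neighborSet u)ᶜ.ncard ≤ (G.neighborSet v)ᶜ.ncard := by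
  have hex : ∀ x : V, ∃ z, x ∈ (G.neighborSet u)ᶜ →
      ¬ G.Adj z v ∧ G.neighborSet z ⊆ G.neighborSet x ∪ G.neighborSet w := by
    intro x
    by_cases hx : x ∈ (G.neighborSet u)ᶜ
    · have hxw : x ≠ w := by
        rintro rfl
        exact hx hwu.symm
      obtain ⟨z, hz⟩ := h.exists_mem_line hiso hftf hxw v
      exact ⟨z, fun _ => hz⟩
    · exact ⟨x, fun hx' => absurd hx' hx⟩
  choose φ hφ using hex
  refine Set.ncard_le_ncard_of_injOn φ (fun x hx e => (hφ x hx).1 (G.adj_symm e)) ?_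
  intro x hx x' hx' hxx'
  have hz := hφ x hx
  have hz' := hφ x' hx'
  rw [← hxx'] at hz'
  have hzw : ¬ G.neighborSet (φ x) ⊆ G.neighborSet w := fun hsub =>
    hz.1 (h.eq_of_neighborSet_subset hiso hftf hsub ▸ hwv)
  have h₁ := h.exchange hiso {w} (x := x') (y := φ x)
    (by rw [openNbhd_singleton]; exact hz'.2) (by rwa [openNbhd_singleton])
  rw [openNbhd_singleton] at h₁
  by_contra hne
  have h₂ := h.exchange hiso {x} (x := w) (y := x')
    (by
      rw [openNbhd_singleton]
      intro t ht
      rcases h₁ ht with ht | ht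
      · exact (hz.2 ht).symm
      · exact Or.inl ht)
    (by
      rw [openNbhd_singleton]
      exact fun hsub => hne (h.eq_of_neighborSet_subset hiso hftf hsub).symm)
  rw [openNbhd_singleton] at h₂
  rcases h₂ hwu with e | e
  · exact hx' (G.adj_symm e)
  · exact hx (G.adj_symm e)

theorem TotalKUniform.ncard_neighborSet_eq {V : Type*} [Finite V] {G : SimpleGraph V} {k : ℕ}
    (h : TotalKUniform G k) (hiso : NoIsolatedVerts G) (hftf : FalseTwinFree G) {u v w : V}
    (hwu : G.Adj w u) (hwv : G.Adj w v) :
    (G.neighborSet u).ncard = (G.neighborSet v).ncard := by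
  have h₁ := h.ncard_compl_le hiso hftf hwu hwv
  have h₂ := h.ncard_compl_le hiso hftf hwv hwu
  have h₃ := Set.ncard_add_ncard_compl (G.neighborSet u)
  have h₄ := Set.ncard_add_ncard_compl (G.neighborSet v)
  omega

open Classical in
/-- A function summing to zero over every open neighborhood sums to zero over the complement of
every flat. -/
theorem TotalKUniform.sum_compl_flat_eq_zero {V : Type*} [Fintype V] {G : SimpleGraph V} {k : ℕ}
    (h : TotalKUniform G k) (hiso : NoIsolatedVerts G) {f : V → ℚ}
    (hf : ∀ y, ∑ x with G.Adj y x, f x = 0) (C : Set V) :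
    ∑ x with ¬ G.neighborSet x ⊆ openNbhd G C, f x = 0 := by
  induction hn : Finset.card {x | ¬ G.neighborSet x ⊆ openNbhd G C}
    using Nat.strong_induction_on generalizing C with
  | _ n ih =>
    set U : Finset V := {x | ¬ G.neighborSet x ⊆ openNbhd G C} with hU
    by_cases hC : ∃ w, w ∉ openNbhd G C
    swap
    · push Not at hC
      have : U = ∅ := by
        ext x
        simp only [hU, Finset.mem_filter_univ, Finset.notMem_empty, iff_false, not_not]
        exact fun w _ => hC w
      rw [this, Finset.sum_empty]
    obtain ⟨w, hw⟩ := hC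
    have hsub : ∀ x, G.Adj w x → x ∈ U := fun x hx => by
      simp only [hU, Finset.mem_filter_univ]
      exact fun hsub => hw (hsub hx.symm)
    by_cases hall : ∀ x ∈ U, G.Adj w x
    · rw [← hf w]
      refine Finset.sum_congr ?_ fun _ _ => rfl
      ext x
      simp only [Finset.mem_filter_univ]
      exact ⟨hall x, hsub x⟩
    push Not at hall
    obtain ⟨x₀, hx₀, hwx₀⟩ := hall
    obtain ⟨x₁, hx₁⟩ := hiso w
    have hclass : ∀ x ∈ U, ∑ v ∈ U with
        openNbhd G (insert v C) = openNbhd G (insert x C), f v = ∑ v ∈ U, f v := by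
      intro x hx
      have hss : ({v | ¬ G.neighborSet v ⊆ openNbhd G (insert x C)} : Finset V) =
          U.filter fun v => ¬ openNbhd G (insert v C) = openNbhd G (insert x C) := by
        ext v
        simp only [hU, Finset.mem_filter, Finset.mem_univ, true_and]
          at hx ⊢
        simp only [openNbhd_insert]
        constructor
        · intro hv
          refine ⟨fun hv' => hv (hv'.trans Set.subset_union_right), fun he => hv ?_⟩
          rw [← he]
          exact Set.subset_union_left
        · rintro ⟨hv, hne⟩ hv'
          refine hne (Set.Subset.antisymm ?_ ?_)
          · exact Set.union_subset hv' Set.subset_union_right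
          · exact Set.union_subset (h.exchange hiso C hv' hv) Set.subset_union_right
      have hlt : Finset.card {v | ¬ G.neighborSet v ⊆ openNbhd G (insert x C)} < n := by
        rw [← hn, hss]
        refine Finset.card_lt_card (Finset.filter_ssubset.2 ⟨x, hx, by simp⟩)
      have h0 := ih _ hlt (insert x C) rfl
      rw [hss] at h0
      rw [← Finset.sum_filter_add_sum_filter_not U
        (fun v => openNbhd G (insert v C) = openNbhd G (insert x C)) f, h0, add_zero]
    set I := U.image fun v => openNbhd G (insert v C) with hI
    have hfib := Finset.sum_fiberwise_of_maps_to (s := U) (t := I)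
      (g := fun v => openNbhd G (insert v C)) (fun v hv => Finset.mem_image_of_mem _ hv) f
    have hconst : ∀ b ∈ I, ∑ v ∈ U with openNbhd G (insert v C) = b, f v = ∑ v ∈ U, f v := by
      intro b hb
      obtain ⟨x, hx, rfl⟩ := Finset.mem_image.1 hb
      exact hclass x hx
    rw [Finset.sum_congr rfl hconst, Finset.sum_const, nsmul_eq_mul] at hfib
    have hcard : 1 < I.card := by
      refine Finset.one_lt_card.2 ⟨_, Finset.mem_image_of_mem _ hx₀, _,
        Finset.mem_image_of_mem _ (hsub x₁ hx₁), fun he => ?_⟩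
      have hmem : w ∈ openNbhd G (insert x₁ C) := ⟨x₁, Set.mem_insert _ _, hx₁.symm⟩
      rw [← he, openNbhd_insert] at hmem
      rcases hmem with e | e
      · exact hwx₀ (G.adj_symm e)
      · exact hw e
    have hcard' : (1 : ℚ) < I.card := by exact_mod_cast hcard
    have : ((I.card : ℚ) - 1) * ∑ v ∈ U, f v = 0 := by linarith
    rcases mul_eq_zero.1 this with e | e
    · linarith
    · exact e

open Classical in
theorem TotalKUniform.det_adjMatrix_ne_zero {V : Type*} [Fintype V] {G : SimpleGraph V} {k : ℕ}
    (h : TotalKUniform G k) (hiso : NoIsolatedVerts G) (hftf : FalseTwinFree G) :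
    (G.adjMatrix ℚ).det ≠ 0 := by
  intro hdet
  obtain ⟨f, hf0, hf⟩ := Matrix.exists_mulVec_eq_zero_iff.2 hdet
  have hsum : ∀ y, ∑ x with G.Adj y x, f x = 0 := by
    intro y
    have := congrFun hf y
    rwa [SimpleGraph.adjMatrix_mulVec_apply, SimpleGraph.neighborFinset_eq_filter] at this
  refine hf0 (funext fun x => ?_)
  have h₀ := h.sum_compl_flat_eq_zero hiso hsum ∅
  have h₁ := h.sum_compl_flat_eq_zero hiso hsum {x}
  have e₀ : ({v | ¬ G.neighborSet v ⊆ openNbhd G ∅} : Finset V) = Finset.univ := by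
    ext v
    simp only [openNbhd_empty, Finset.mem_filter_univ, Finset.mem_univ, iff_true]
    obtain ⟨w, hw⟩ := hiso v
    exact fun hsub => hsub hw
  have e₁ : ({v | ¬ G.neighborSet v ⊆ openNbhd G {x}} : Finset V) = Finset.univ.erase x := by
    ext v
    simp only [openNbhd_singleton, Finset.mem_filter_univ, Finset.mem_erase, Finset.mem_univ,
      and_true, ne_eq, not_iff_not]
    exact ⟨h.eq_of_neighborSet_subset hiso hftf, fun e => e ▸ subset_rfl⟩
  rw [e₀] at h₀
  rw [e₁] at h₁
  rw [← Finset.add_sum_erase _ _ (Finset.mem_univ x), h₁, add_zero] at h₀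
  exact h₀

open Classical in
theorem TotalKUniform.exists_perm_adj {V : Type*} [Fintype V] {G : SimpleGraph V} {k : ℕ}
    (h : TotalKUniform G k) (hiso : NoIsolatedVerts G) (hftf : FalseTwinFree G) :
    ∃ σ : Equiv.Perm V, ∀ v, G.Adj v (σ v) := by
  have hdet := h.det_adjMatrix_ne_zero hiso hftf
  rw [Matrix.det_apply] at hdet
  obtain ⟨σ, -, hσ⟩ := Finset.exists_ne_zero_of_sum_ne_zero hdet
  refine ⟨σ, fun v => ?_⟩
  by_contra hv
  refine hσ ?_
  rw [Finset.prod_eq_zero (Finset.mem_univ v), smul_zero]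
  simpa [SimpleGraph.adjMatrix_apply] using fun e => hv (G.adj_symm e)

/-- If all neighbors of each vertex `v` have the same degree as `σ v` for a permutation `σ`, then
`σ` preserves degrees. -/
theorem SimpleGraph.degree_perm_eq {V : Type*} [Fintype V] {G : SimpleGraph V}
    [DecidableRel G.Adj] {σ : Equiv.Perm V} (hd : ∀ v w, G.Adj v w → G.degree w = G.degree (σ v))
    (v : V) : G.degree (σ v) = G.degree v := by
  have h₁ : ∑ v, (G.degree v : ℤ) * G.degree (σ v) = ∑ w, (G.degree w : ℤ) ^ 2 := by
    calc ∑ v, (G.degree v : ℤ) * G.degree (σ v)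
        = ∑ v, ∑ w, if G.Adj v w then (G.degree w : ℤ) else 0 := by
          refine Finset.sum_congr rfl fun v _ => ?_
          rw [← Finset.sum_filter, ← SimpleGraph.neighborFinset_eq_filter,
            Finset.sum_congr rfl fun w hw =>
              congrArg Nat.cast (hd v w ((G.mem_neighborFinset v w).1 hw))]
          simp
      _ = ∑ w, ∑ v, if G.Adj v w then (G.degree w : ℤ) else 0 := Finset.sum_comm
      _ = ∑ w, (G.degree w : ℤ) ^ 2 := by
          refine Finset.sum_congr rfl fun w _ => ?_
          simp_rw [G.adj_comm _ w]
          rw [← Finset.sum_filter, ← SimpleGraph.neighborFinset_eq_filter]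
          simp [sq]
  have h₂ : ∑ v, (G.degree (σ v) : ℤ) ^ 2 = ∑ v, (G.degree v : ℤ) ^ 2 :=
    Equiv.sum_comp σ fun v => (G.degree v : ℤ) ^ 2
  have h₃ : ∑ v, ((G.degree (σ v) : ℤ) - G.degree v) ^ 2 = 0 := by
    have : ∀ v, ((G.degree (σ v) : ℤ) - G.degree v) ^ 2 = (G.degree (σ v) : ℤ) ^ 2 +
        (G.degree v : ℤ) ^ 2 - 2 * ((G.degree v : ℤ) * G.degree (σ v)) := fun v => by ring
    simp_rw [this]
    rw [Finset.sum_sub_distrib, Finset.sum_add_distrib, ← Finset.mul_sum, h₁, h₂]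
    ring
  have h₄ := (Finset.sum_eq_zero_iff_of_nonneg fun v _ => sq_nonneg _).1 h₃ v (Finset.mem_univ v)
  have h₅ := pow_eq_zero_iff two_ne_zero |>.1 h₄
  omega

/-- Every connected, false twin-free, total `k`-uniform graph (`k` even and positive) is
regular. -/
theorem stmt_15 {V : Type*} [Finite V] (G : SimpleGraph V) (k : ℕ) (hk0 : 0 < k)
    (hke : Even k) (hiso : NoIsolatedVerts G) (hconn : G.Connected)
    (hftf : FalseTwinFree G) (huni : TotalKUniform G k) :
    IsRegularGraph G := by
  classical
  have := Fintype.ofFinite V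
  have hdeg : ∀ v, (G.neighborSet v).ncard = G.degree v := fun v => by
    rw [Set.ncard_eq_toFinset_card', ← SimpleGraph.card_neighborFinset_eq_degree]
    rfl
  obtain ⟨σ, hσ⟩ := huni.exists_perm_adj hiso hftf
  have hnb : ∀ v w, G.Adj v w → G.degree w = G.degree (σ v) := fun v w hvw => by
    rw [← hdeg, ← hdeg]
    exact huni.ncard_neighborSet_eq hiso hftf hvw (hσ v)
  have hadj : ∀ v w, G.Adj v w → G.degree v = G.degree w := fun v w hvw => by
    rw [hnb v w hvw, SimpleGraph.degree_perm_eq hnb v]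
  intro u v
  rw [hdeg, hdeg]
  obtain ⟨p⟩ := hconn.preconnected u v
  induction p with
  | nil => rfl
  | cons e _ ih => exact (hadj _ _ e).trans ih
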